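/- For the Bresinsky sequence, order the 2q₂ generators S = {f_μ : 1 ≤ μ ≤ q₂} ∪ {h_m : 1 ≤ m ≤ q₂−2} ∪ {g₁, g₂} of 𝔭(n₁,n₂,n₃,n₄) (where f_μ = x₁^{μ−1}x₃^{q₂−μ} − x₂^{q₂−μ}x₄^{μ+1}, h_m = x₁^{m}x₄^{q₁−m} − x₂^{q₂−m}x₃^{m}, g₁ = x₁^{d₁} − x₂^{q₂}, g₂ = x₃x₄ − x₁x₂). Then the syzygy module Syz(S), i.e., the kernel of the R-linear map R^{2q₂} → R sending the standard basis vectors to the elements of S, has minimal number of generators 4(q₂ − 1): it admits a generating set of cardinality 4(q₂−1) and no generating set of smaller cardinality. -/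

import Mathlib

open Polynomial

/-- The ordered list of the `2q₂` Bresinsky generators of `𝔭(n₁,n₂,n₃,n₄)`:
first `f_μ = x₁^{μ−1}x₃^{q₂−μ} − x₂^{q₂−μ}x₄^{μ+1}` for `1 ≤ μ ≤ q₂`, then
`h_m = x₁^m x₄^{q₁−m} − x₂^{q₂−m}x₃^m` for `1 ≤ m ≤ q₂−2`, then
`g₁ = x₁^{d₁} − x₂^{q₂}` and `g₂ = x₃x₄ − x₁x₂`, where `q₁ = q₂ + 1`,
`d₁ = q₂ − 1`, and `x₁,x₂,x₃,x₄` are the variables indexed by `0,1,2,3 : Fin 4`. -/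
noncomputable def bresinskyGens (k : Type*) [Field k] (q₂ : ℕ) :
    Fin (2 * q₂) → MvPolynomial (Fin 4) k := fun i =>
  if (i : ℕ) < q₂ then
    MvPolynomial.X 0 ^ (((i : ℕ) + 1) - 1) * MvPolynomial.X 2 ^ (q₂ - ((i : ℕ) + 1)) -
      MvPolynomial.X 1 ^ (q₂ - ((i : ℕ) + 1)) * MvPolynomial.X 3 ^ (((i : ℕ) + 1) + 1)
  else if (i : ℕ) < 2 * q₂ - 2 then
    MvPolynomial.X 0 ^ ((i : ℕ) - q₂ + 1) *
        MvPolynomial.X 3 ^ ((q₂ + 1) - ((i : ℕ) - q₂ + 1)) -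
      MvPolynomial.X 1 ^ (q₂ - ((i : ℕ) - q₂ + 1)) * MvPolynomial.X 2 ^ ((i : ℕ) - q₂ + 1)
  else if (i : ℕ) = 2 * q₂ - 2 then
    MvPolynomial.X 0 ^ (q₂ - 1) - MvPolynomial.X 1 ^ q₂
  else
    MvPolynomial.X 2 * MvPolynomial.X 3 - MvPolynomial.X 0 * MvPolynomial.X 1

/-- If `a e_i = c e_{i+1}` and `d e_i = b e_{i+1}` for all `i < n`, with `n` positive, then an
element `a^i b^j c^k d^l e_m` with `m ≤ n` depends only on `i + k`, `j + l` and `i + l + m`. -/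
theorem monomial_smul_eq_of_ladder {R N : Type*} [CommRing R] [AddCommGroup N] [Module R N]
    {a b c d : R} {e : ℕ → N} {n : ℕ} (hn : 0 < n)
    (hac : ∀ i < n, c • e (i + 1) = a • e i) (hdb : ∀ i < n, b • e (i + 1) = d • e i)
    {i j k l m i' j' k' l' m' : ℕ} (hm : m ≤ n) (hm' : m' ≤ n)
    (hik : i + k = i' + k') (hjl : j + l = j' + l') (hilm : i + l + m = i' + l' + m') :
    (a ^ i * b ^ j * c ^ k * d ^ l) • e m = (a ^ i' * b ^ j' * c ^ k' * d ^ l') • e m' := by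
  have hquad : ∀ i ≤ n, (a * b) • e i = (c * d) • e i := by
    intro i hi
    rcases hi.lt_or_eq with hi | rfl
    · rw [mul_comm, mul_smul, ← hac i hi, mul_smul, ← hdb i hi, smul_comm]
    · obtain ⟨p, rfl⟩ := Nat.exists_eq_succ_of_ne_zero hn.ne'
      have h1 := hac p (Nat.lt_succ_self p)
      have h2 := hdb p (Nat.lt_succ_self p)
      rw [Nat.succ_eq_add_one, mul_smul, h2, mul_comm c d, mul_smul, h1, smul_comm]
  have hpow : ∀ i ≤ n, ∀ δ : ℕ, (a * b) ^ δ • e i = (c * d) ^ δ • e i := by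
    intro i hi δ
    induction δ with
    | zero => simp
    | succ δ ih => rw [pow_succ, mul_smul, hquad i hi, smul_comm, ih, ← mul_smul, pow_succ']
  have hsame : ∀ m ≤ n, ∀ i j k l δ : ℕ,
      (a ^ (i + δ) * b ^ (j + δ) * c ^ k * d ^ l) • e m =
        (a ^ i * b ^ j * c ^ (k + δ) * d ^ (l + δ)) • e m := by
    intro m hm i j k l δ
    calc _ = (a ^ i * b ^ j * c ^ k * d ^ l) • (a * b) ^ δ • e m := by
            rw [← mul_smul]; congr 1; ring
      _ = _ := by rw [hpow m hm, ← mul_smul]; congr 1; ring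
  wlog hle : m ≤ m' generalizing i j k l m i' j' k' l' m'
  · exact (this hm' hm hik.symm hjl.symm hilm.symm (by omega)).symm
  obtain ⟨s, rfl⟩ := Nat.exists_eq_add_of_le hle
  induction s generalizing i j k l m with
  | zero =>
    rcases le_total i i' with h | h
    · obtain ⟨δ, rfl⟩ := Nat.exists_eq_add_of_le h
      obtain rfl : j' = j + δ := by omega
      obtain rfl : k = k' + δ := by omega
      obtain rfl : l = l' + δ := by omega
      exact (hsame m hm i j k' l' δ).symm
    · obtain ⟨δ, rfl⟩ := Nat.exists_eq_add_of_le h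
      obtain rfl : j = j' + δ := by omega
      obtain rfl : k' = k + δ := by omega
      obtain rfl : l' = l + δ := by omega
      exact hsame m hm i' j' k l δ
  | succ s ih =>
    have hm1 : m + 1 + s = m + (s + 1) := by ring
    rcases Nat.eq_zero_or_pos i with rfl | hi
    · obtain ⟨l, rfl⟩ := Nat.exists_eq_add_of_le' (show 0 < l by omega)
      have := ih (i := 0) (j := j + 1) (k := k) (l := l) (m := m + 1) (by omega) hik
        (by omega) (by omega) (by omega) (by omega)
      rw [hm1] at this
      rw [← this, pow_succ b, pow_succ d,
        show a ^ 0 * b ^ j * c ^ k * (d ^ l * d) = (a ^ 0 * b ^ j * c ^ k * d ^ l) * d by ring,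
        mul_smul, ← hdb m (by omega), ← mul_smul]
      congr 1
      ring
    · obtain ⟨i, rfl⟩ := Nat.exists_eq_add_of_le' hi
      have := ih (i := i) (j := j) (k := k + 1) (l := l) (m := m + 1) (by omega) (by omega)
        (by omega) (by omega) (by omega) (by omega)
      rw [hm1] at this
      rw [← this, pow_succ a, pow_succ c,
        show a ^ i * a * b ^ j * c ^ k * d ^ l = (a ^ i * b ^ j * c ^ k * d ^ l) * a by ring,
        mul_smul, ← hac m (by omega), ← mul_smul]
      congr 1
      ring

open MvPolynomial in
/-- A linear map out of a polynomial ring in three variables may be prescribed on monomials. -/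
theorem exists_linearMap_monomial_three {k N : Type*} [Field k] [AddCommGroup N] [Module k N]
    (v : ℕ × ℕ × ℕ → N) : ∃ Ψ : MvPolynomial (Fin 3) k →ₗ[k] N,
      ∀ α β γ : ℕ, Ψ (X 0 ^ α * X 1 ^ β * X 2 ^ γ) = v (α, β, γ) := by
  refine ⟨(basisMonomials (Fin 3) k).constr k fun w => v (w 0, w 1, w 2), fun α β γ => ?_⟩
  have h : (X 0 ^ α * X 1 ^ β * X 2 ^ γ : MvPolynomial (Fin 3) k) = basisMonomials (Fin 3) k
      (Finsupp.single 0 α + Finsupp.single 1 β + Finsupp.single 2 γ) := by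
    simp [MvPolynomial.X_pow_eq_monomial, monomial_mul]
  rw [h, Module.Basis.constr_basis]
  simp

open MvPolynomial in
/-- The affine chart of the Segre parametrization of the quadric `x₃x₄ = x₁x₂`. -/
noncomputable def segreChart (k : Type*) [Field k] :
    MvPolynomial (Fin 4) k →ₐ[k] MvPolynomial (Fin 3) k :=
  aeval ![X 0 * X 2, X 1, X 0, X 1 * X 2]

open MvPolynomial in
theorem segreChart_monomial {k : Type*} [Field k] (i j l m : ℕ) :
    segreChart k (X 0 ^ i * X 1 ^ j * X 2 ^ l * X 3 ^ m) =
      X 0 ^ (i + l) * X 1 ^ (j + m) * X 2 ^ (i + m) := by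
  simp [segreChart]
  ring

open MvPolynomial in
/-- A pair `(r • z, r p)` lies in a `k`-subspace as soon as it does so for all monomials `r`. -/
theorem smul_chart_mem_of_forall_monomial {k N : Type*} [Field k] [AddCommGroup N]
    [Module (MvPolynomial (Fin 4) k) N] [Module k N] [IsScalarTower k (MvPolynomial (Fin 4) k) N]
    (W : Submodule k (N × MvPolynomial (Fin 3) k)) (z : N) (p : MvPolynomial (Fin 3) k)
    (hW : ∀ i j l m : ℕ, ((X 0 ^ i * X 1 ^ j * X 2 ^ l * X 3 ^ m : MvPolynomial (Fin 4) k) • z,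
      X 0 ^ (i + l) * X 1 ^ (j + m) * X 2 ^ (i + m) * p) ∈ W)
    (r : MvPolynomial (Fin 4) k) : (r • z, segreChart k r * p) ∈ W := by
  induction r using MvPolynomial.induction_on' with
  | monomial s a =>
    have hs : monomial s a =
        a • (X 0 ^ s 0 * X 1 ^ s 1 * X 2 ^ s 2 * X 3 ^ s 3 : MvPolynomial (Fin 4) k) := by
      rw [monomial_eq, MvPolynomial.smul_eq_C_mul, Finsupp.prod_fintype _ _ (by simp),
        Fin.prod_univ_four]
    have := W.smul_mem a (hW (s 0) (s 1) (s 2) (s 3))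
    rw [hs, map_smul, segreChart_monomial, smul_assoc, smul_mul_assoc]
    exact this
  | add r₁ r₂ h₁ h₂ =>
    rw [map_add, add_mul, add_smul]
    exact W.add_mem h₁ h₂

open MvPolynomial in
/-- The pairs `(Ψ A + Θ B, F A + H B)` with `B` of degree less than `n` in the variable `x₀`. -/
noncomputable def normalPairs {k N : Type*} [Field k] [AddCommGroup N] [Module k N]
    {n : ℕ} (hn : 0 < n) (F H : MvPolynomial (Fin 3) k) (Ψ Θ : MvPolynomial (Fin 3) k →ₗ[k] N) :
    Submodule k (N × MvPolynomial (Fin 3) k) where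
  carrier := {y | ∃ A B, degreeOf 0 B < n ∧ y = (Ψ A + Θ B, F * A + H * B)}
  zero_mem' := ⟨0, 0, by simpa using hn, by simp only [map_zero, mul_zero, add_zero]; rfl⟩
  add_mem' := by
    rintro _ _ ⟨A, B, hB, rfl⟩ ⟨A', B', hB', rfl⟩
    refine ⟨A + A', B + B', (degreeOf_add_le _ _ _).trans_lt (max_lt hB hB'), ?_⟩
    rw [Prod.mk_add_mk, map_add, map_add, mul_add, mul_add, add_add_add_comm,
      add_add_add_comm (F * A)]
  smul_mem' := by
    rintro a _ ⟨A, B, hB, rfl⟩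
    refine ⟨a • A, a • B, ?_, ?_⟩
    · rw [MvPolynomial.smul_eq_C_mul]
      exact (degreeOf_C_mul_le _ _ _).trans_lt hB
    · rw [Prod.smul_mk, map_smul, map_smul, smul_add, smul_add, mul_smul_comm, mul_smul_comm]

open MvPolynomial in
/-- If `F A + H B = 0`, where `F = x₀ ^ n - x₁ ^ (n + 2) x₂ ^ 2`, `H = x₁ x₂ ^ (n + 2) - 1`, and
`B` has degree less than `n` in `x₀`, then `A = B = 0`. -/
theorem eq_zero_of_chart_relation {k : Type*} [Field k] {n : ℕ} (hn : 0 < n)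
    {A B : MvPolynomial (Fin 3) k} (hB : degreeOf 0 B < n)
    (h : (X 0 ^ n - X 1 ^ (n + 2) * X 2 ^ 2) * A + (X 1 * X 2 ^ (n + 2) - 1) * B = 0) :
    A = 0 ∧ B = 0 := by
  have hH : (X 1 * X 2 ^ (n + 2) - 1 : MvPolynomial (Fin 3) k) ≠ 0 := by
    intro h0
    have := congrArg MvPolynomial.constantCoeff h0
    simp at this
  have hA : A = 0 := by
    by_contra hA
    have hF : n ≤ degreeOf 0 (X 0 ^ n - X 1 ^ (n + 2) * X 2 ^ 2 : MvPolynomial (Fin 3) k) := by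
      have hmem : Finsupp.single 0 n ∈
          (X 0 ^ n - X 1 ^ (n + 2) * X 2 ^ 2 : MvPolynomial (Fin 3) k).support := by
        rw [MvPolynomial.mem_support_iff]
        have : Finsupp.single (1 : Fin 3) (n + 2) + Finsupp.single 2 2 ≠ Finsupp.single 0 n := by
          intro h
          simpa using DFunLike.congr_fun h 1
        rw [MvPolynomial.coeff_sub, MvPolynomial.X_pow_eq_monomial,
          MvPolynomial.X_pow_eq_monomial, MvPolynomial.X_pow_eq_monomial,
          MvPolynomial.monomial_mul, MvPolynomial.coeff_monomial, MvPolynomial.coeff_monomial,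
          if_pos rfl, if_neg this, sub_zero]
        exact one_ne_zero
      simpa using monomial_le_degreeOf 0 hmem
    have hF0 : (X 0 ^ n - X 1 ^ (n + 2) * X 2 ^ 2 : MvPolynomial (Fin 3) k) ≠ 0 := by
      intro h0
      rw [h0] at hF
      simp at hF
      omega
    have hdeg := degreeOf_mul_eq (n := 0) hF0 hA
    have hdeg' : degreeOf 0 ((X 1 * X 2 ^ (n + 2) - 1) * B) < n := by
      refine (degreeOf_mul_le _ _ _).trans_lt ?_
      have : degreeOf 0 (X 1 * X 2 ^ (n + 2) - 1 : MvPolynomial (Fin 3) k) = 0 := by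
        refine Nat.le_zero.mp ((degreeOf_sub_le _ _ _).trans ?_)
        simp [degreeOf_mul_X_pow_of_ne, degreeOf_X]
      omega
    rw [eq_neg_of_add_eq_zero_left h, degreeOf_neg] at hdeg
    omega
  subst hA
  simpa [hH] using h

open MvPolynomial in
/-- Let `f_0, …, f_n` and `h_0, …, h_n` satisfy the relations of the listed shape. Then there is
a `k`-linear correspondence `W` between `N` and `k[x₀, x₁, x₂]`, injective over zero, containing
the graph of `r f_i ↦ r x₂^i F` and of `r h_m ↦ r x₀^m x₁^(n+1-m) H`. -/
theorem exists_injective_correspondence {k N : Type*} [Field k] [AddCommGroup N]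
    [Module (MvPolynomial (Fin 4) k) N] [Module k N] [IsScalarTower k (MvPolynomial (Fin 4) k) N]
    {n : ℕ} (hn : 0 < n) {f h : ℕ → N}
    (hf₁ : ∀ i < n, (X 2 : MvPolynomial (Fin 4) k) • f (i + 1) =
      (X 0 : MvPolynomial (Fin 4) k) • f i)
    (hf₂ : ∀ i < n, (X 1 : MvPolynomial (Fin 4) k) • f (i + 1) =
      (X 3 : MvPolynomial (Fin 4) k) • f i)
    (hh₁ : ∀ i < n, (X 3 : MvPolynomial (Fin 4) k) • h (i + 1) =
      (X 0 : MvPolynomial (Fin 4) k) • h i)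
    (hh₂ : ∀ i < n, (X 1 : MvPolynomial (Fin 4) k) • h (i + 1) =
      (X 2 : MvPolynomial (Fin 4) k) • h i)
    (hfh : h n = (X 3 ^ 2 : MvPolynomial (Fin 4) k) • f n - (X 1 : MvPolynomial (Fin 4) k) • f 0 +
      (X 3 ^ 2 : MvPolynomial (Fin 4) k) • h 0) :
    ∃ W : Submodule k (N × MvPolynomial (Fin 3) k),
      (∀ i ≤ n, ∀ r : MvPolynomial (Fin 4) k, (r • f i, segreChart k r *
        (X 2 ^ i * (X 0 ^ n - X 1 ^ (n + 2) * X 2 ^ 2))) ∈ W) ∧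
      (∀ m ≤ n, ∀ r : MvPolynomial (Fin 4) k, (r • h m, segreChart k r *
        (X 0 ^ m * X 1 ^ (n + 1 - m) * (X 1 * X 2 ^ (n + 2) - 1))) ∈ W) ∧
      ∀ z, (z, 0) ∈ W → z = 0 := by
  set F : MvPolynomial (Fin 3) k := X 0 ^ n - X 1 ^ (n + 2) * X 2 ^ 2 with hF
  set H : MvPolynomial (Fin 3) k := X 1 * X 2 ^ (n + 2) - 1 with hH
  let x (t : ℕ × ℕ × ℕ × ℕ) : MvPolynomial (Fin 4) k :=
    X 0 ^ t.1 * X 1 ^ t.2.1 * X 2 ^ t.2.2.1 * X 3 ^ t.2.2.2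
  obtain ⟨Ψ, hΨ⟩ : ∃ Ψ : MvPolynomial (Fin 3) k →ₗ[k] N, ∀ i j l s m, m ≤ n →
      Ψ (X 0 ^ (i + l) * X 1 ^ (j + s) * X 2 ^ (i + s + m)) = x (i, j, l, s) • f m := by
    let D := {t : (ℕ × ℕ × ℕ × ℕ) × ℕ // t.2 ≤ n}
    let g : D → ℕ × ℕ × ℕ := fun t => (t.1.1.1 + t.1.1.2.2.1, t.1.1.2.1 + t.1.1.2.2.2,
      t.1.1.1 + t.1.1.2.2.2 + t.1.2)
    let v : D → N := fun t => x t.1.1 • f t.1.2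
    have hv : v.FactorsThrough g := by
      rintro ⟨⟨⟨i, j, l, s⟩, m⟩, hm⟩ ⟨⟨⟨i', j', l', s'⟩, m'⟩, hm'⟩ h
      simp only [g, Prod.mk.injEq] at h
      exact monomial_smul_eq_of_ladder hn hf₁ hf₂ hm hm' h.1 h.2.1 h.2.2
    obtain ⟨Ψ, hΨ⟩ := exists_linearMap_monomial_three (k := k) (Function.extend g v 0)
    refine ⟨Ψ, fun i j l s m hm => ?_⟩
    rw [hΨ]
    exact hv.extend_apply 0 ⟨((i, j, l, s), m), hm⟩
  obtain ⟨Θ, hΘ⟩ := exists_linearMap_monomial_three (k := k) fun w : ℕ × ℕ × ℕ =>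
    x (0, w.2.1 - w.2.2 - (n + 1 - w.1), 0, w.2.2) • h w.1
  have hWf : ∀ i ≤ n, ∀ r : MvPolynomial (Fin 4) k, (r • f i, segreChart k r *
        (X 2 ^ i * F)) ∈ normalPairs hn F H Ψ Θ := by
    intro i hi r
    refine smul_chart_mem_of_forall_monomial _ _ _ (fun a b c d => ?_) r
    refine ⟨X 0 ^ (a + c) * X 1 ^ (b + d) * X 2 ^ (a + d + i), 0, by simpa using hn, ?_⟩
    rw [hΨ _ _ _ _ _ hi, map_zero, add_zero, mul_zero, add_zero, pow_add _ _ i]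
    congr 1
    ring
  have hWh_monomial : ∀ α m i j l s, m ≤ n → i + l + m = α → (x (i, j, l, s) • h m,
      X 0 ^ (i + l + m) * X 1 ^ (j + s + (n + 1 - m)) * X 2 ^ (i + s) * H) ∈
        normalPairs hn F H Ψ Θ := by
    intro α
    induction α using Nat.strong_induction_on with
    | _ α ih =>
      intro m i j l s hm hα
      have hladder : ∀ i' j' l' s' m', m' ≤ n → l + j = l' + j' → s + i = s' + i' →
          l + i + m = l' + i' + m' → x (i, j, l, s) • h m = x (i', j', l', s') • h m' := by
        intro i' j' l' s' m' hm' h₁ h₂ h₃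
        have := monomial_smul_eq_of_ladder hn hh₂ hh₁ hm hm' h₁ h₂ h₃
        convert this using 2 <;> simp only [x] <;> ring
      rcases lt_or_ge α n with hαn | hαn
      · refine ⟨0, X 0 ^ α * X 1 ^ (j + s + (n + 1 - m)) * X 2 ^ (i + s), ?_, ?_⟩
        · rw [degreeOf_mul_X_pow_of_ne _ (by decide), degreeOf_mul_X_pow_of_ne _ (by decide),
            degreeOf_X_self_pow]
          exact hαn
        · rw [hΘ, map_zero, zero_add, mul_zero, zero_add, hα, mul_comm H]
          congr 1
          exact hladder _ _ _ _ _ hαn.le (by dsimp only; omega) (by dsimp only; omega)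
            (by dsimp only; omega)
      · obtain ⟨i', l', hi', hl', hil⟩ : ∃ i' l', i' ≤ i ∧ l' ≤ l ∧ i' + l' + n = α :=
          ⟨min i (α - n), α - n - min i (α - n), by omega, by omega, by omega⟩
        obtain ⟨s', hs'⟩ : ∃ s', s' + i' = s + i := ⟨s + i - i', by omega⟩
        obtain ⟨j', hj'⟩ : ∃ j', j' + l' = j + l := ⟨j + l - l', by omega⟩
        rw [hladder i' j' l' s' n le_rfl (by omega) (by omega) (by omega)]
        have h₁ := hWf n le_rfl (x (i', j', l', s' + 2))
        have h₂ := hWf 0 (Nat.zero_le n) (x (i', j' + 1, l', s'))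
        have h₃ := ih (i' + l') (by omega) 0 i' j' l' (s' + 2) (Nat.zero_le n) rfl
        have h₄ := Submodule.add_mem _ (Submodule.sub_mem _ h₁ h₂) h₃
        rw [Prod.mk_sub_mk, Prod.mk_add_mk] at h₄
        have hx₁ : x (i', j', l', s' + 2) = x (i', j', l', s') * X 3 ^ 2 := by
          simp only [x]; ring
        have hx₂ : x (i', j' + 1, l', s') = x (i', j', l', s') * X 1 := by
          simp only [x]; ring
        convert h₄ using 2
        · rw [hfh, hx₁, hx₂, smul_add, smul_sub, smul_smul, smul_smul, smul_smul]
        · simp only [x, segreChart_monomial]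
          rw [show i + l + m = i' + l' + n by omega,
            show j + s + (n + 1 - m) = j' + s' + 1 by omega,
            show i + s = i' + s' by omega, Nat.sub_zero, hF, hH]
          ring
  refine ⟨normalPairs hn F H Ψ Θ, hWf, ?_, ?_⟩
  · intro m hm r
    refine smul_chart_mem_of_forall_monomial _ _ _ (fun i j l s => ?_) r
    convert hWh_monomial _ m i j l s hm rfl using 2
    ring
  · rintro z ⟨A, B, hB, hAB⟩
    obtain ⟨hz, h0⟩ := Prod.mk.inj hAB
    obtain ⟨rfl, rfl⟩ := eq_zero_of_chart_relation hn hB h0.symm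
    rw [hz, map_zero, map_zero, add_zero]

/-- The `m`-th standard basis vector of `R ^ (2 q)`, zero when `m` is out of range. -/
noncomputable def unitVec (k : Type*) [Field k] (q m : ℕ) : Fin (2 * q) → MvPolynomial (Fin 4) k :=
  fun l => if (l : ℕ) = m then 1 else 0

open MvPolynomial in
/-- A vector representing `h_m = x₁^m x₄^(q+1-m) - x₂^(q-m) x₃^m` in terms of the Bresinsky
generators, for `0 ≤ m ≤ q - 1`. -/
noncomputable def hVec (k : Type*) [Field k] (q m : ℕ) : Fin (2 * q) → MvPolynomial (Fin 4) k :=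
  if m = 0 then unitVec k q (2 * q - 2) - unitVec k q (q - 1)
  else if m = q - 1 then
    (X 3 ^ 2 : MvPolynomial (Fin 4) k) • unitVec k q (2 * q - 2) -
      (X 1 : MvPolynomial (Fin 4) k) • unitVec k q 0
  else unitVec k q (q + m - 1)

open MvPolynomial in
/-- The minimal syzygies of the Bresinsky generators. -/
noncomputable def bresinskySyz (k : Type*) [Field k] (q i : ℕ) :
    Fin 4 → Fin (2 * q) → MvPolynomial (Fin 4) k :=
  ![(X 2 : MvPolynomial (Fin 4) k) • unitVec k q (i + 1) -
      (X 0 : MvPolynomial (Fin 4) k) • unitVec k q i +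
      (X 1 ^ (q - 2 - i) * X 3 ^ (i + 2) : MvPolynomial (Fin 4) k) • unitVec k q (2 * q - 1),
    (X 1 : MvPolynomial (Fin 4) k) • unitVec k q (i + 1) -
      (X 3 : MvPolynomial (Fin 4) k) • unitVec k q i +
      (X 0 ^ i * X 2 ^ (q - 2 - i) : MvPolynomial (Fin 4) k) • unitVec k q (2 * q - 1),
    (X 3 : MvPolynomial (Fin 4) k) • hVec k q (i + 1) -
      (X 0 : MvPolynomial (Fin 4) k) • hVec k q i +
      (X 1 ^ (q - 1 - i) * X 2 ^ i : MvPolynomial (Fin 4) k) • unitVec k q (2 * q - 1),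
    (X 1 : MvPolynomial (Fin 4) k) • hVec k q (i + 1) -
      (X 2 : MvPolynomial (Fin 4) k) • hVec k q i +
      (X 0 ^ i * X 3 ^ (q - i) : MvPolynomial (Fin 4) k) • unitVec k q (2 * q - 1)]

section Evaluation

open MvPolynomial

variable {k : Type*} [Field k] {q : ℕ}

theorem linearCombination_unitVec {m : ℕ} (hm : m < 2 * q) :
    Fintype.linearCombination (MvPolynomial (Fin 4) k) (bresinskyGens k q) (unitVec k q m) =
      bresinskyGens k q ⟨m, hm⟩ := by
  rw [Fintype.linearCombination_apply, Finset.sum_eq_single ⟨m, hm⟩]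
  · simp [unitVec]
  · intro l _ hl
    simp [unitVec, Fin.ext_iff.not.mp hl]
  · simp

theorem linearCombination_unitVec_of_lt {i : ℕ} (hi : i < q) :
    Fintype.linearCombination (MvPolynomial (Fin 4) k) (bresinskyGens k q) (unitVec k q i) =
      X 0 ^ i * X 2 ^ (q - 1 - i) - X 1 ^ (q - 1 - i) * X 3 ^ (i + 2) := by
  rw [linearCombination_unitVec (by omega), bresinskyGens, if_pos hi, Nat.add_sub_cancel,
    Nat.sub_sub, Nat.add_comm 1 i]

theorem linearCombination_unitVec_penultimate (hq : 2 ≤ q) :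
    Fintype.linearCombination (MvPolynomial (Fin 4) k) (bresinskyGens k q)
      (unitVec k q (2 * q - 2)) = X 0 ^ (q - 1) - X 1 ^ q := by
  rw [linearCombination_unitVec (by omega), bresinskyGens, if_neg (by simp; omega),
    if_neg (by simp), if_pos rfl]

theorem linearCombination_unitVec_last (hq : 2 ≤ q) :
    Fintype.linearCombination (MvPolynomial (Fin 4) k) (bresinskyGens k q)
      (unitVec k q (2 * q - 1)) = X 2 * X 3 - X 0 * X 1 := by
  rw [linearCombination_unitVec (by omega), bresinskyGens, if_neg (by simp; omega),
    if_neg (by simp; omega), if_neg (by simp; omega)]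

theorem linearCombination_hVec (hq : 2 ≤ q) {m : ℕ} (hm : m < q) :
    Fintype.linearCombination (MvPolynomial (Fin 4) k) (bresinskyGens k q) (hVec k q m) =
      X 0 ^ m * X 3 ^ (q + 1 - m) - X 1 ^ (q - m) * X 2 ^ m := by
  rw [hVec]
  split_ifs with h₁ h₂
  · subst h₁
    rw [map_sub, linearCombination_unitVec_penultimate hq, linearCombination_unitVec_of_lt
      (by omega), Nat.sub_self, show q - 1 + 2 = q + 1 by omega]
    simp
  · subst h₂
    rw [map_sub, map_smul, map_smul, linearCombination_unitVec_penultimate hq,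
      linearCombination_unitVec_of_lt (by omega), show q + 1 - (q - 1) = 2 by omega,
      show q - (q - 1) = 1 by omega]
    obtain ⟨n, rfl⟩ := Nat.exists_eq_add_of_le' (show 1 ≤ q by omega)
    simp only [smul_eq_mul, Nat.add_sub_cancel, Nat.sub_zero]
    ring
  · rw [linearCombination_unitVec (by omega), bresinskyGens, if_neg (by simp; omega),
      if_pos (by simp; omega)]
    simp only [show q + m - 1 - q + 1 = m by omega]

theorem linearCombination_bresinskySyz (hq : 2 ≤ q) {i : ℕ} (hi : i < q - 1) (j : Fin 4) :
    Fintype.linearCombination (MvPolynomial (Fin 4) k) (bresinskyGens k q)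
      (bresinskySyz k q i j) = 0 := by
  obtain ⟨s, rfl⟩ := Nat.exists_eq_add_of_le (show i + 2 ≤ q by omega)
  have e₁ : i + 2 + s - 1 - (i + 1) = s := by omega
  have e₂ : i + 2 + s - 1 - i = s + 1 := by omega
  have e₃ : i + 2 + s - 2 - i = s := by omega
  have e₄ : i + 2 + s + 1 - (i + 1) = s + 2 := by omega
  have e₅ : i + 2 + s + 1 - i = s + 3 := by omega
  have e₆ : i + 2 + s - (i + 1) = s + 1 := by omega
  have e₇ : i + 2 + s - i = s + 2 := by omega
  fin_cases j <;>
  simp only [bresinskySyz, Fin.zero_eta, Fin.mk_one, Fin.reduceFinMk, Matrix.cons_val,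
    map_add, map_sub, map_smul, linearCombination_unitVec_last hq,
    linearCombination_unitVec_of_lt (k := k) (show i < i + 2 + s by omega),
    linearCombination_unitVec_of_lt (k := k) (show i + 1 < i + 2 + s by omega),
    linearCombination_hVec (k := k) hq (show i < i + 2 + s by omega),
    linearCombination_hVec (k := k) hq (show i + 1 < i + 2 + s by omega),
    e₁, e₂, e₃, e₄, e₅, e₆, e₇, smul_eq_mul] <;>
  ring

end Evaluation

section Generation

open MvPolynomial

variable {k : Type*} [Field k] {q : ℕ}

theorem eq_sum_smul_unitVec (v : Fin (2 * q) → MvPolynomial (Fin 4) k) :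
    v = ∑ l, v l • unitVec k q l := by
  ext1 l
  rw [Finset.sum_apply, Finset.sum_eq_single l]
  · simp [unitVec]
  · intro l' _ hl
    simp [unitVec, Fin.ext_iff.not.mp hl.symm]
  · simp

theorem segreChart_f {n i : ℕ} (hi : i ≤ n) :
    segreChart k (X 0 ^ i * X 2 ^ (n - i) - X 1 ^ (n - i) * X 3 ^ (i + 2)) =
      X 2 ^ i * (X 0 ^ n - X 1 ^ (n + 2) * X 2 ^ 2) := by
  obtain ⟨s, rfl⟩ := Nat.exists_eq_add_of_le hi
  simp [segreChart]
  ring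

theorem segreChart_h {n m : ℕ} (hm : m ≤ n) :
    segreChart k (X 0 ^ m * X 3 ^ (n + 1 + 1 - m) - X 1 ^ (n + 1 - m) * X 2 ^ m) =
      X 0 ^ m * X 1 ^ (n + 1 - m) * (X 1 * X 2 ^ (n + 2) - 1) := by
  obtain ⟨s, rfl⟩ := Nat.exists_eq_add_of_le hm
  rw [show m + s + 1 + 1 - m = s + 2 by omega, show m + s + 1 - m = s + 1 by omega]
  simp [segreChart]
  ring

theorem span_range_bresinskySyz (hq : 2 ≤ q) :
    Submodule.span (MvPolynomial (Fin 4) k)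
      (Set.range fun p : Fin (q - 1) × Fin 4 => bresinskySyz k q p.1 p.2) =
        LinearMap.ker (Fintype.linearCombination (MvPolynomial (Fin 4) k) (bresinskyGens k q)) := by
  apply le_antisymm
  · rw [Submodule.span_le]
    rintro _ ⟨p, rfl⟩
    exact linearCombination_bresinskySyz hq p.1.2 p.2
  obtain ⟨n, rfl⟩ := Nat.exists_eq_add_of_le' (show 1 ≤ q by omega)
  set ev := Fintype.linearCombination (MvPolynomial (Fin 4) k) (bresinskyGens k (n + 1)) with hev
  set S := Submodule.span (MvPolynomial (Fin 4) k)
    (Set.range fun p : Fin (n + 1 - 1) × Fin 4 => bresinskySyz k (n + 1) p.1 p.2) with hS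
  set u := unitVec k (n + 1) (2 * (n + 1) - 1) with hu
  set Z := S ⊔ Submodule.span (MvPolynomial (Fin 4) k) {u} with hZ
  have hu_mem : u ∈ Z := Submodule.mem_sup_right (Submodule.mem_span_singleton_self u)
  have hrel : ∀ i < n, ∀ j : Fin 4, bresinskySyz k (n + 1) i j ∈ Z := fun i hi j =>
    Submodule.mem_sup_left (Submodule.subset_span ⟨(⟨i, hi⟩, j), rfl⟩)
  have hladder : ∀ (x y p : MvPolynomial (Fin 4) k)
      (a b : Fin (2 * (n + 1)) → MvPolynomial (Fin 4) k), x • a - y • b + p • u ∈ Z →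
      x • Z.mkQ a = y • Z.mkQ b := by
    intro x y p a b h
    rw [← map_smul, ← map_smul, ← sub_eq_zero, ← map_sub, Submodule.mkQ_apply,
      Submodule.Quotient.mk_eq_zero]
    simpa using Z.sub_mem h (Z.smul_mem p hu_mem)
  obtain ⟨W, hWf, hWh, hW⟩ := exists_injective_correspondence (k := k) (n := n) (by omega)
    (f := fun i => Z.mkQ (unitVec k (n + 1) i)) (h := fun m => Z.mkQ (hVec k (n + 1) m))
    (fun i hi => hladder _ _ _ _ _ (hrel i hi 0)) (fun i hi => hladder _ _ _ _ _ (hrel i hi 1))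
    (fun i hi => hladder _ _ _ _ _ (hrel i hi 2)) (fun i hi => hladder _ _ _ _ _ (hrel i hi 3))
    (by
      simp only [← map_smul, ← map_sub, ← map_add]
      congr 1
      rw [hVec, if_neg (by omega), if_pos (by omega), hVec, if_pos rfl, Nat.add_sub_cancel]
      module)
  have hunit : ∀ l < 2 * (n + 1), ∀ r : MvPolynomial (Fin 4) k,
      (r • Z.mkQ (unitVec k (n + 1) l),
        segreChart k r * segreChart k (ev (unitVec k (n + 1) l))) ∈ W := by
    intro l hl r
    have hf : ∀ i ≤ n, (r • Z.mkQ (unitVec k (n + 1) i),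
        segreChart k r * segreChart k (ev (unitVec k (n + 1) i))) ∈ W := by
      intro i hi
      rw [hev, linearCombination_unitVec_of_lt (by omega), Nat.add_sub_cancel, segreChart_f hi]
      exact hWf i hi r
    have hh : ∀ m ≤ n, (r • Z.mkQ (hVec k (n + 1) m),
        segreChart k r * segreChart k (ev (hVec k (n + 1) m))) ∈ W := by
      intro m hm
      rw [hev, linearCombination_hVec hq (by omega), segreChart_h hm]
      exact hWh m hm r
    rcases Nat.lt_or_ge l (n + 1) with h₁ | h₁
    · exact hf l (by omega)
    rcases Nat.lt_or_ge l (2 * (n + 1) - 2) with h₂ | h₂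
    · have := hh (l - n) (by omega)
      rwa [hVec, if_neg (by omega), if_neg (by omega),
        show n + 1 + (l - n) - 1 = l by omega] at this
    rcases h₂.eq_or_lt with rfl | h₃
    · have := W.add_mem (hh 0 (Nat.zero_le n)) (hf n le_rfl)
      rw [hVec, if_pos rfl, Nat.add_sub_cancel, Prod.mk_add_mk, ← smul_add, ← mul_add,
        ← map_add, ← map_add, ← map_add, sub_add_cancel] at this
      exact this
    · obtain rfl : l = 2 * (n + 1) - 1 := by omega
      have h₄ : Z.mkQ (unitVec k (n + 1) (2 * (n + 1) - 1)) = 0 := by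
        rw [Submodule.mkQ_apply, Submodule.Quotient.mk_eq_zero]
        exact hu_mem
      rw [h₄, hev, linearCombination_unitVec_last hq]
      have h₅ : segreChart k (X 2 * X 3 - X 0 * X 1) = 0 := by
        simp [segreChart]
        ring
      rw [h₅, smul_zero, mul_zero]
      exact W.zero_mem
  intro v hv
  rw [LinearMap.mem_ker] at hv
  have hvW : (Z.mkQ v, segreChart k (ev v)) ∈ W := by
    have := W.sum_mem (t := Finset.univ) fun l _ => hunit (l : Fin (2 * (n + 1))) l.2 (v l)
    convert this using 1
    refine Prod.ext ?_ ?_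
    · conv_lhs => rw [eq_sum_smul_unitVec v]
      simp only [map_sum, map_smul, Prod.fst_sum]
    · conv_lhs => rw [eq_sum_smul_unitVec v]
      simp only [map_sum, map_smul, smul_eq_mul, map_mul, Prod.snd_sum]
  rw [hv, map_zero] at hvW
  have hvZ : v ∈ Z := by
    rw [← Submodule.Quotient.mk_eq_zero, ← Submodule.mkQ_apply]
    exact hW _ hvW
  obtain ⟨s, hs, t, ht, rfl⟩ := Submodule.mem_sup.mp hvZ
  obtain ⟨r, rfl⟩ := Submodule.mem_span_singleton.mp ht
  have hs0 : ev s = 0 := by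
    have : S ≤ LinearMap.ker ev := by
      rw [hS, Submodule.span_le]
      rintro _ ⟨p, rfl⟩
      exact linearCombination_bresinskySyz hq p.1.2 p.2
    exact this hs
  have hg : (X 2 * X 3 - X 0 * X 1 : MvPolynomial (Fin 4) k) ≠ 0 := by
    intro h
    have := congrArg (MvPolynomial.aeval (R := k) ![(0 : k), 0, 1, 1]) h
    simp at this
  rw [map_add, hs0, zero_add, map_smul, hu, hev, linearCombination_unitVec_last hq, smul_eq_mul,
    mul_eq_zero, or_iff_left hg] at hv
  rwa [hv, zero_smul, add_zero]

end Generation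

section Minimality

open MvPolynomial

variable {k : Type*} [Field k] {q : ℕ}

theorem constantCoeff_pderiv_X_mul (i j : Fin 4) (p : MvPolynomial (Fin 4) k) :
    constantCoeff (pderiv i (X j * p)) = if j = i then constantCoeff p else 0 := by
  rw [pderiv_mul, pderiv_X]
  rcases eq_or_ne j i with rfl | h
  · simp
  · simp [h]

theorem constantCoeff_unitVec (m : ℕ) (l : Fin (2 * q)) :
    constantCoeff (unitVec k q m l) = if (l : ℕ) = m then 1 else 0 := by
  rw [unitVec]
  split_ifs <;> simp

theorem constantCoeff_hVec (m : ℕ) (l : Fin (2 * q)) :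
    constantCoeff (hVec k q m l) =
      if m = 0 then (if (l : ℕ) = 2 * q - 2 then 1 else 0) - (if (l : ℕ) = q - 1 then 1 else 0)
      else if m = q - 1 then 0 else if (l : ℕ) = q + m - 1 then 1 else 0 := by
  rw [hVec]
  by_cases h₁ : m = 0
  · simp [h₁, constantCoeff_unitVec]
  by_cases h₂ : m = q - 1
  · simp [h₁, if_pos h₂]
  · simp [h₁, h₂, constantCoeff_unitVec]

theorem constantCoeff_bresinskySyz (hq : 3 ≤ q) {i : ℕ} (hi : i < q - 1) (j : Fin 4)
    (l : Fin (2 * q)) : constantCoeff (bresinskySyz k q i j l) = 0 := by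
  have h₁ : q - 1 - i ≠ 0 := by omega
  have h₂ : q - i ≠ 0 := by omega
  have h₃ : i = 0 → q - 2 - i ≠ 0 := by omega
  fin_cases j <;> simp [bresinskySyz, h₁, h₂]
  by_cases h : i = 0
  · exact Or.inl (Or.inr (h₃ h))
  · exact Or.inl (Or.inl h)

/-- The coordinate and the variable whose linear coefficient detects a minimal syzygy. -/
def pivot (q i : ℕ) (j : Fin 4) : ℕ × Fin 4 :=
  ![(i, 0), (i, 3), (if i = 0 then 2 * q - 2 else q + i - 1, 0),
    (if i = 0 then 2 * q - 2 else q + i - 1, 2)] j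

theorem pivot_lt {i : ℕ} (hi : i < q - 1) (j : Fin 4) : (pivot q i j).1 < 2 * q - 1 := by
  fin_cases j <;> simp [pivot] <;> (try split_ifs) <;> omega

theorem constantCoeff_pderiv_pivot_bresinskySyz {i i' : ℕ} (hi : i < q - 1) (hi' : i' < q - 1)
    (j j' : Fin 4) (l : Fin (2 * q)) (hl : (l : ℕ) = (pivot q i j).1) :
    constantCoeff (pderiv (pivot q i j).2 (bresinskySyz k q i' j' l)) =
      if i = i' ∧ j = j' then -1 else 0 := by
  have hlast : unitVec k q (2 * q - 1) l = 0 := by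
    have := pivot_lt hi j
    rw [unitVec, if_neg (by omega)]
  fin_cases j' <;>
  simp only [bresinskySyz, Fin.zero_eta, Fin.mk_one, Fin.reduceFinMk, Matrix.cons_val,
    Pi.add_apply, Pi.sub_apply, Pi.smul_apply, smul_eq_mul, hlast, mul_zero, add_zero, map_sub,
    constantCoeff_pderiv_X_mul, constantCoeff_unitVec, constantCoeff_hVec] <;>
  fin_cases j <;>
  simp [pivot] at hl ⊢ <;> (try split_ifs at hl ⊢) <;> first | omega | simp

end Minimality

/-- A set with the same span as a family of vectors without constant terms has at least as many
elements as the family, provided suitable linear coefficients are dual to the family. -/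
theorem card_le_card_of_span_eq {k σ L ι : Type*} [Field k] [Fintype ι] [DecidableEq ι]
    {v : ι → L → MvPolynomial σ k} (hv : ∀ i l, MvPolynomial.constantCoeff (v i l) = 0)
    (x : ι → σ) (y : ι → L)
    (hvxy : ∀ i j, MvPolynomial.constantCoeff (MvPolynomial.pderiv (x i) (v j (y i))) =
      if i = j then -1 else 0)
    {T : Finset (L → MvPolynomial σ k)}
    (hT : Submodule.span (MvPolynomial σ k) (T : Set (L → MvPolynomial σ k)) =
      Submodule.span (MvPolynomial σ k) (Set.range v)) :
    Fintype.card ι ≤ T.card := by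
  classical
  let π : (L → MvPolynomial σ k) →ₗ[k] ι → k := LinearMap.pi fun i =>
    (MvPolynomial.lcoeff k (0 : σ →₀ ℕ)).comp
      ((MvPolynomial.pderiv (R := k) (x i)).toLinearMap.comp (LinearMap.proj (y i)))
  have hπ : ∀ w i, π w i = MvPolynomial.constantCoeff (MvPolynomial.pderiv (x i) (w (y i))) :=
    fun _ _ => rfl
  have hzero : ∀ w ∈ Submodule.span (MvPolynomial σ k) (Set.range v), ∀ l,
      MvPolynomial.constantCoeff (w l) = 0 := by
    intro w hw
    induction hw using Submodule.span_induction with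
    | mem w hw => obtain ⟨i, rfl⟩ := hw; exact hv i
    | zero => simp
    | add w₁ w₂ _ _ h₁ h₂ => simp [h₁, h₂]
    | smul r w _ h => simp [h]
  have hspan : ∀ w ∈ Submodule.span (MvPolynomial σ k) (T : Set (L → MvPolynomial σ k)),
      π w ∈ Submodule.span k (T.image π : Set (ι → k)) := by
    intro w hw
    induction hw using Submodule.span_induction with
    | mem w hw => exact Submodule.subset_span (by simpa using ⟨w, hw, rfl⟩)
    | zero => simp
    | add w₁ w₂ _ _ h₁ h₂ => rw [map_add]; exact Submodule.add_mem _ h₁ h₂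
    | smul r w hw h =>
      have : π (r • w) = MvPolynomial.constantCoeff r • π w := by
        ext i
        rw [Pi.smul_apply, hπ, hπ, Pi.smul_apply, smul_eq_mul, MvPolynomial.pderiv_mul, map_add,
          map_mul, map_mul, hzero w (hT ▸ hw), mul_zero, zero_add, smul_eq_mul]
      rw [this]
      exact Submodule.smul_mem _ _ h
  have htop : Submodule.span k (T.image π : Set (ι → k)) = ⊤ := by
    rw [eq_top_iff, ← (Pi.basisFun k ι).span_eq, Submodule.span_le]
    rintro _ ⟨j, rfl⟩
    have h := Submodule.neg_mem _ (hspan (v j) (hT ▸ Submodule.subset_span ⟨j, rfl⟩))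
    convert h using 1
    suffices Pi.basisFun k ι j = -π (v j) by rw [this]; rfl
    ext i
    rw [Pi.neg_apply, hπ, hvxy, Pi.basisFun_apply, Pi.single_apply]
    split_ifs <;> simp
  calc Fintype.card ι = Module.finrank k (ι → k) := Module.finrank_fintype_fun_eq_card k |>.symm
    _ = Module.finrank k (Submodule.span k (T.image π : Set (ι → k))) := by rw [htop, finrank_top]
    _ ≤ (T.image π).card := finrank_span_finset_le_card _
    _ ≤ T.card := Finset.card_image_le

/-- For the Bresinsky sequence (`q₂ ≥ 4` even, `q₁ = q₂+1`,
`d₁ = q₂−1`, `n₁ = q₁q₂`, `n₂ = q₁d₁`, `n₃ = q₁q₂+d₁`, `n₄ = q₂d₁`), with the `2q₂`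
generators of `𝔭(n₁,n₂,n₃,n₄)` ordered as in `bresinskyGens`, the syzygy module
`Syz(S) = {c ∈ R^{2q₂} : Σ c_l g_l = 0}` has minimal number of generators
`4(q₂ − 1)`: it admits a generating set of cardinality `4(q₂−1)` and no finite
generating set of smaller cardinality. -/
theorem bresinsky_second_betti_number (k : Type*) [Field k] (q₂ : ℕ) (hq : 4 ≤ q₂)
    (heven : Even q₂) :
    (∃ T : Finset (Fin (2 * q₂) → MvPolynomial (Fin 4) k), T.card = 4 * (q₂ - 1) ∧
      (Submodule.span (MvPolynomial (Fin 4) k)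
          (T : Set (Fin (2 * q₂) → MvPolynomial (Fin 4) k)) :
        Set (Fin (2 * q₂) → MvPolynomial (Fin 4) k)) =
        {c : Fin (2 * q₂) → MvPolynomial (Fin 4) k |
          ∑ l, c l * bresinskyGens k q₂ l = 0}) ∧
    (∀ T : Finset (Fin (2 * q₂) → MvPolynomial (Fin 4) k),
      (Submodule.span (MvPolynomial (Fin 4) k)
          (T : Set (Fin (2 * q₂) → MvPolynomial (Fin 4) k)) :
        Set (Fin (2 * q₂) → MvPolynomial (Fin 4) k)) =
        {c : Fin (2 * q₂) → MvPolynomial (Fin 4) k |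
          ∑ l, c l * bresinskyGens k q₂ l = 0} →
      4 * (q₂ - 1) ≤ T.card) := by
  have hgen := span_range_bresinskySyz (k := k) (q := q₂) (by omega)
  have hker : (LinearMap.ker (Fintype.linearCombination (MvPolynomial (Fin 4) k)
      (bresinskyGens k q₂)) : Set (Fin (2 * q₂) → MvPolynomial (Fin 4) k)) =
      {c | ∑ l, c l * bresinskyGens k q₂ l = 0} := by
    ext c
    simp [Fintype.linearCombination_apply]
  have hcard : Fintype.card (Fin (q₂ - 1) × Fin 4) = 4 * (q₂ - 1) := by
    simp [mul_comm]
  have hle : ∀ T : Finset (Fin (2 * q₂) → MvPolynomial (Fin 4) k),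
      (Submodule.span (MvPolynomial (Fin 4) k)
          (T : Set (Fin (2 * q₂) → MvPolynomial (Fin 4) k)) :
        Set (Fin (2 * q₂) → MvPolynomial (Fin 4) k)) =
        {c | ∑ l, c l * bresinskyGens k q₂ l = 0} →
      4 * (q₂ - 1) ≤ T.card := by
    intro T hT
    rw [← hker, SetLike.coe_set_eq, ← hgen] at hT
    rw [← hcard]
    have hlt (p : Fin (q₂ - 1) × Fin 4) : (pivot q₂ p.1 p.2).1 < 2 * q₂ :=
      (pivot_lt p.1.2 p.2).trans_le (Nat.sub_le _ _)
    refine card_le_card_of_span_eq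
      (v := fun p : Fin (q₂ - 1) × Fin 4 => bresinskySyz k q₂ p.1 p.2)
      (fun p l => constantCoeff_bresinskySyz (by omega) p.1.2 p.2 l)
      (fun p => (pivot q₂ p.1 p.2).2) (fun p => ⟨(pivot q₂ p.1 p.2).1, hlt p⟩)
      (fun p p' => ?_) hT
    rw [constantCoeff_pderiv_pivot_bresinskySyz p.1.2 p'.1.2 _ _ _ rfl]
    simp only [Prod.ext_iff, Fin.ext_iff]
  classical
  let T : Finset (Fin (2 * q₂) → MvPolynomial (Fin 4) k) :=
    Finset.univ.image fun p : Fin (q₂ - 1) × Fin 4 => bresinskySyz k q₂ p.1 p.2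
  have hT : (Submodule.span (MvPolynomial (Fin 4) k)
      (T : Set (Fin (2 * q₂) → MvPolynomial (Fin 4) k)) :
        Set (Fin (2 * q₂) → MvPolynomial (Fin 4) k)) =
        {c | ∑ l, c l * bresinskyGens k q₂ l = 0} := by
    rw [← hker, ← hgen, Finset.coe_image, Finset.coe_univ, Set.image_univ]
  exact ⟨⟨T, le_antisymm (hcard ▸ Finset.card_image_le) (hle T hT), hT⟩, hle⟩
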